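/- arXiv:1110.6583 — 2 statements merged into one kernel-verified Lean document; each statement's English description precedes it below -/
import Mathlib

section
/- Let ρ_0 and ρ_1 be density matrices on a finite-dimensional complex Hilbert space such that range(ρ_1) is not contained in range(ρ_0). Then there exists x* ∈ (0,1) such that S((1−x*)ρ_0 + x*ρ_1) > S(ρ_0), where S is the von Neumann entropy. -/
open scoped BigOperators ComplexOrder

namespace Paper

/-- The index set of the computational basis of an `n`-partite Hilbert space
`H = H_1 ⊗ ⋯ ⊗ H_n` with `dim H_i = d i`. -/
abbrev Idx {n : ℕ} (d : Fin n → ℕ) : Type := ∀ i : Fin n, Fin (d i)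

/-- The index set for the subsystems in `K ⊆ {1,…,n}`. -/
abbrev SubIdx {n : ℕ} (d : Fin n → ℕ) (K : Finset (Fin n)) : Type :=
  ∀ i : {j : Fin n // j ∈ K}, Fin (d i.1)

/-- The index set for the subsystems outside `K`. -/
abbrev CoIdx {n : ℕ} (d : Fin n → ℕ) (K : Finset (Fin n)) : Type :=
  ∀ i : {j : Fin n // j ∉ K}, Fin (d i.1)

/-- Glue an index on `K` and an index on the complement of `K` to a full index. -/
def merge {n : ℕ} {d : Fin n → ℕ} (K : Finset (Fin n)) (a : SubIdx d K) (c : CoIdx d K) :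
    Idx d := fun i => if h : i ∈ K then a ⟨i, h⟩ else c ⟨i, h⟩

/-- A density matrix: positive semidefinite with trace one. -/
def IsDensityMatrix {m : Type*} [Fintype m] (ρ : Matrix m m ℂ) : Prop :=
  ρ.PosSemidef ∧ ρ.trace = 1

/-- The reduced density matrix `γ_K(ρ)`: the partial trace of `ρ` over all
subsystems outside `K`. -/
noncomputable def rdm {n : ℕ} {d : Fin n → ℕ} (K : Finset (Fin n))
    (ρ : Matrix (Idx d) (Idx d) ℂ) : Matrix (SubIdx d K) (SubIdx d K) ℂ :=
  fun a b => ∑ c : CoIdx d K, ρ (merge K a c) (merge K b c)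

/-- The von Neumann entropy `S(ρ) = -Tr(ρ log ρ)`, computed through the eigenvalues. -/
noncomputable def entropy {m : Type*} [Fintype m] [DecidableEq m] (ρ : Matrix m m ℂ) : ℝ :=
  if h : ρ.IsHermitian then ∑ i, Real.negMulLog (h.eigenvalues i) else 0

/-- `P` is the orthogonal projection (w.r.t. the standard inner product) onto `V`. -/
def IsProjectionOnto {m : Type*} [Fintype m] [DecidableEq m] (P : Matrix m m ℂ)
    (V : Submodule ℂ (m → ℂ)) : Prop :=
  P.IsHermitian ∧ P * P = P ∧ LinearMap.range P.mulVecLin = V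

/-- The maximally mixed state `ρ_V = P_V / dim V` on `V`, expressed through a
projection `P` onto `V`. -/
noncomputable def mmix {m : Type*} [Fintype m] [DecidableEq m] (V : Submodule ℂ (m → ℂ))
    (P : Matrix m m ℂ) : Matrix m m ℂ :=
  ((Module.finrank ℂ V : ℂ))⁻¹ • P

/-- A subspace `V` is `𝒦`-correlated if the maximally mixed state `ρ_V` on `V` is the
unique state of maximal von Neumann entropy among all states having the same
reduced density matrices `γ_K`, `K ∈ 𝒦`, as `ρ_V`. -/
def KCorrelated {n : ℕ} {d : Fin n → ℕ} (𝒦 : Finset (Finset (Fin n)))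
    (V : Submodule ℂ (Idx d → ℂ)) : Prop :=
  ∃ P : Matrix (Idx d) (Idx d) ℂ, IsProjectionOnto P V ∧
    IsDensityMatrix (mmix V P) ∧
    ∀ σ : Matrix (Idx d) (Idx d) ℂ, IsDensityMatrix σ →
      (∀ K ∈ 𝒦, rdm K σ = rdm K (mmix V P)) → σ ≠ mmix V P →
      entropy σ < entropy (mmix V P)

/-- `V` is the eigenspace of `H` for the eigenvalue `E`, and `E` is minimal
(`H - E•1` is positive semidefinite); i.e. `V` is the ground-state space of `H`
with ground energy `E`. -/
def IsGroundStateSpace {m : Type*} [Fintype m] [DecidableEq m] (H : Matrix m m ℂ) (E : ℝ)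
    (V : Submodule ℂ (m → ℂ)) : Prop :=
  (H - (E : ℂ) • 1).PosSemidef ∧ ∀ v : m → ℂ, v ∈ V ↔ H.mulVec v = (E : ℂ) • v

/-- Restriction of a full index to the subsystems in `K`. -/
def restrict {n : ℕ} {d : Fin n → ℕ} (K : Finset (Fin n)) (x : Idx d) : SubIdx d K :=
  fun i => x i.1

/-- Restriction of a full index to the subsystems outside `K`. -/
def corestrict {n : ℕ} {d : Fin n → ℕ} (K : Finset (Fin n)) (x : Idx d) : CoIdx d K :=
  fun i => x i.1

/-- The operator `B ⊗ I`: an operator `B` on the subsystems in `K`, tensored with the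
identity on all other subsystems. -/
noncomputable def embed {n : ℕ} {d : Fin n → ℕ} (K : Finset (Fin n))
    (B : Matrix (SubIdx d K) (SubIdx d K) ℂ) : Matrix (Idx d) (Idx d) ℂ :=
  fun x y => if corestrict K x = corestrict K y then B (restrict K x) (restrict K y) else 0

/-- `A` acts nontrivially only on the subsystems in `K`. -/
def ActsOn {n : ℕ} {d : Fin n → ℕ} (K : Finset (Fin n)) (A : Matrix (Idx d) (Idx d) ℂ) :
    Prop := ∃ B, A = embed K B

/-- `H` is `𝒦`-local: a sum of Hermitian terms, each acting nontrivially only on the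
subsystems in some `K ∈ 𝒦`. -/
def IsKLocal {n : ℕ} {d : Fin n → ℕ} (𝒦 : Finset (Finset (Fin n)))
    (H : Matrix (Idx d) (Idx d) ℂ) : Prop :=
  ∃ (M : ℕ) (T : Fin M → Matrix (Idx d) (Idx d) ℂ),
    H = ∑ j, T j ∧ ∀ j, (T j).IsHermitian ∧ ∃ K ∈ 𝒦, ActsOn K (T j)

/-- The subspace `S ⊗ (full space of the complement of K)` of the full Hilbert space. -/
noncomputable def liftSpace {n : ℕ} {d : Fin n → ℕ} (K : Finset (Fin n))
    (S : Submodule ℂ (SubIdx d K → ℂ)) : Submodule ℂ (Idx d → ℂ) where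
  carrier := {x | ∀ c : CoIdx d K, (fun a => x (merge K a c)) ∈ S}
  zero_mem' := fun _ => S.zero_mem
  add_mem' := fun hx hy c => S.add_mem (hx c) (hy c)
  smul_mem' := fun t _ hx c => S.smul_mem t (hx c)


/-- The basis state `|v⟩`. -/
def ket {m : Type*} [DecidableEq m] (v : m) : m → ℂ := fun x => if x = v then 1 else 0

/-- The pure-state density matrix `|ψ⟩⟨ψ|`. -/
def pureDM {m : Type*} (ψ : m → ℂ) : Matrix m m ℂ := Matrix.vecMulVec ψ (star ψ)

/-- `𝒦`-correlatedness for an interaction pattern given as a tuple `(K_1, …, K_M)`. -/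
def KCorrelatedT {n : ℕ} {d : Fin n → ℕ} {M : ℕ} (K : Fin M → Finset (Fin n))
    (V : Submodule ℂ (Idx d → ℂ)) : Prop :=
  ∃ P : Matrix (Idx d) (Idx d) ℂ, IsProjectionOnto P V ∧
    IsDensityMatrix (mmix V P) ∧
    ∀ σ : Matrix (Idx d) (Idx d) ℂ, IsDensityMatrix σ →
      (∀ j : Fin M, rdm (K j) σ = rdm (K j) (mmix V P)) → σ ≠ mmix V P →
      entropy σ < entropy (mmix V P)


lemma klein_aux {m : Type*} [Fintype m] (d : m → m → ℝ) (q mu l : m → ℝ)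
    (hd : ∀ i j, 0 ≤ d i j) (hd1 : ∀ i, ∑ j, d i j = 1) (hd2 : ∀ j, ∑ i, d i j = 1)
    (hmu : ∀ j, 0 ≤ mu j) (hl : ∀ i, 0 ≤ l i) (hq : ∀ i, q i = ∑ j, mu j * d i j)
    (hz : ∀ i, l i = 0 → q i = 0) (hs : ∑ j, mu j = ∑ i, l i) :
    ∑ j, Real.negMulLog (mu j) ≤ ∑ i, q i * (- Real.log (l i)) := by
  have key : ∀ i j, d i j * (mu j - l i) ≤
      d i j * (mu j * Real.log (mu j)) - mu j * d i j * Real.log (l i) := by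
    intro i j
    rcases (hl i).eq_or_lt with h | h
    · have h0 := hz i h.symm
      rw [hq] at h0
      have h1 := (Finset.sum_eq_zero_iff_of_nonneg
        (fun j _ => mul_nonneg (hmu j) (hd i j))).1 h0 j (Finset.mem_univ j)
      rw [← h]
      have : d i j * (mu j * Real.log (mu j)) = 0 := by
        rw [← mul_assoc, mul_comm (d i j), h1, zero_mul]
      rw [this, h1]
      linarith
    · rcases (hmu j).eq_or_lt with h' | h'
      · rw [← h']
        have := mul_nonneg (hd i j) h.le
        simp; linarith
      · have h2 := Real.log_le_sub_one_of_pos (div_pos h h')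
        rw [Real.log_div h.ne' h'.ne'] at h2
        have h3 : mu j * (Real.log (l i) - Real.log (mu j)) ≤ l i - mu j := by
          calc _ ≤ mu j * (l i / mu j - 1) := by gcongr
            _ = _ := by field_simp
        have := mul_le_mul_of_nonneg_left h3 (hd i j)
        linarith
  have h1 : ∑ i, ∑ j, d i j * (mu j - l i) = 0 := by
    simp_rw [mul_sub, Finset.sum_sub_distrib, ← Finset.sum_mul, hd1]
    rw [Finset.sum_comm]
    simp_rw [← Finset.sum_mul, hd2]
    simp [hs]
  have h2 := Finset.sum_le_sum (s := Finset.univ) (fun i _ =>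
    Finset.sum_le_sum (s := Finset.univ) (fun j _ => key i j))
  rw [h1] at h2
  simp_rw [Finset.sum_sub_distrib, ← Finset.sum_mul, ← hq] at h2
  rw [Finset.sum_comm] at h2
  simp_rw [← Finset.sum_mul, hd2] at h2
  simp only [Real.negMulLog, mul_neg, neg_mul, Finset.sum_neg_distrib]
  simp only [one_mul] at h2
  linarith

lemma big_aux {m : Type*} [Fintype m] (w p l : m → ℝ) (y t e : ℝ) (ht : 0 < t) (ht1 : t ≤ 1)
    (hl : ∀ i, 0 ≤ l i) (hl1 : ∀ i, l i ≤ 1)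
    (hz : ∀ i, l i = 0 → p i = 0) (hp : ∑ i, p i ^ 2 = 1)
    (hw : ∑ i, w i ^ 2 = 1) (hwl : ∑ i, l i * w i ^ 2 = e)
    (hy0 : 0 ≤ y) (hy : y ≤ ∑ i, w i * p i) :
    y ^ 2 ≤ (1 / (1 - Real.log t) + e / t) * (1 + ∑ i, p i ^ 2 * (- Real.log (l i))) := by
  have hL : ∀ i, 0 < 1 - Real.log (l i) := fun i => by
    have := Real.log_nonpos (hl i) (hl1 i); linarith
  have hT : 0 < 1 - Real.log t := by
    have := Real.log_nonpos ht.le ht1; linarith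
  let f : m → ℝ := fun i => if l i = 0 then 0 else w i / √(1 - Real.log (l i))
  let g : m → ℝ := fun i => p i * √(1 - Real.log (l i))
  have hfg : ∀ i, w i * p i = f i * g i := by
    intro i
    by_cases h : l i = 0
    · simp [f, g, h, hz i h]
    · have := (Real.sqrt_pos.2 (hL i)).ne'
      simp only [f, g, h, if_false]
      field_simp
  have hf : ∀ i, f i ^ 2 ≤ w i ^ 2 * (1 / (1 - Real.log t)) + l i * w i ^ 2 / t := by
    intro i
    have hli := hl i
    by_cases h : l i = 0
    · simp only [f, if_pos h]
      rw [zero_pow two_ne_zero]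
      positivity
    · have hpos : 0 < l i := lt_of_le_of_ne (hl i) (Ne.symm h)
      simp only [f, h, if_false]
      rw [div_pow, Real.sq_sqrt (hL i).le]
      have : 1 / (1 - Real.log (l i)) ≤ 1 / (1 - Real.log t) + l i / t := by
        rcases le_total (l i) t with h1 | h1
        · have h2 : 1 / (1 - Real.log (l i)) ≤ 1 / (1 - Real.log t) := by
            apply one_div_le_one_div_of_le hT
            have := Real.log_le_log hpos h1
            linarith
          have : 0 ≤ l i / t := by positivity
          linarith
        · have h2 : 1 / (1 - Real.log (l i)) ≤ 1 := by
            rw [div_le_one (hL i)]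
            have := Real.log_nonpos (hl i) (hl1 i); linarith
          have h3 : 1 ≤ l i / t := by rwa [one_le_div ht]
          have : 0 ≤ 1 / (1 - Real.log t) := by positivity
          linarith
      have := mul_le_mul_of_nonneg_left this (sq_nonneg (w i))
      calc w i ^ 2 / (1 - Real.log (l i)) = w i ^ 2 * (1 / (1 - Real.log (l i))) := by ring
        _ ≤ _ := this
        _ = _ := by ring
  have hg : ∑ i, g i ^ 2 = 1 + ∑ i, p i ^ 2 * (- Real.log (l i)) := by
    rw [← hp, ← Finset.sum_add_distrib]
    refine Finset.sum_congr rfl fun i _ => ?_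
    simp only [g]
    rw [mul_pow, Real.sq_sqrt (hL i).le]; ring
  calc y ^ 2 ≤ (∑ i, w i * p i) ^ 2 := by gcongr
    _ = (∑ i, f i * g i) ^ 2 := by simp_rw [hfg]
    _ ≤ (∑ i, f i ^ 2) * ∑ i, g i ^ 2 := Finset.sum_mul_sq_le_sq_mul_sq _ _ _
    _ ≤ (1 / (1 - Real.log t) + e / t) * ∑ i, g i ^ 2 := by
        refine mul_le_mul_of_nonneg_right ?_ (Finset.sum_nonneg fun i _ => sq_nonneg _)
        refine (Finset.sum_le_sum fun i _ => hf i).trans ?_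
        rw [Finset.sum_add_distrib, ← Finset.sum_mul, ← Finset.sum_div, hw, hwl, one_mul]
    _ = _ := by rw [hg]

lemma quad_eq {m E : Type*} [Fintype m] [NormedAddCommGroup E] [InnerProductSpace ℂ E]
    (f : OrthonormalBasis m ℂ E) (T : E →ₗ[ℂ] E) (mu : m → ℝ)
    (h : ∀ j, T (f j) = (mu j : ℂ) • f j) (u : E) :
    (inner ℂ u (T u)).re = ∑ j, mu j * ‖inner ℂ (f j) u‖ ^ 2 := by
  have h1 : T u = ∑ j, (inner ℂ (f j) u * mu j) • f j := by
    conv_lhs => rw [← f.sum_repr' u]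
    simp only [map_sum, map_smul, h, smul_smul]
  rw [h1, inner_sum, Complex.re_sum]
  refine Finset.sum_congr rfl fun j _ => ?_
  rw [inner_smul_right, ← inner_conj_symm u (f j)]
  have : inner ℂ (f j) u * (mu j : ℂ) * (starRingEnd ℂ) (inner ℂ (f j) u)
      = ((mu j * ‖inner ℂ (f j) u‖ ^ 2 : ℝ) : ℂ) := by
    rw [mul_right_comm, Complex.mul_conj, Complex.normSq_eq_norm_sq]
    push_cast; ring
  rw [this, Complex.ofReal_re]

lemma eig_apply {m : Type*} [Fintype m] [DecidableEq m] {A : Matrix m m ℂ} (hA : A.IsHermitian)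
    (j : m) : A.toEuclideanLin (hA.eigenvectorBasis j) =
      (hA.eigenvalues j : ℂ) • hA.eigenvectorBasis j := by
  apply (WithLp.ofLp_injective 2)
  rw [Matrix.ofLp_toEuclideanLin_apply, hA.mulVec_eigenvectorBasis]
  ext i; simp

lemma sum_eig {m : Type*} [Fintype m] [DecidableEq m] {A : Matrix m m ℂ} (hA : A.IsHermitian)
    (h : A.trace = 1) : ∑ i, hA.eigenvalues i = 1 := by
  have := hA.trace_eq_sum_eigenvalues
  rw [h] at this
  have h2 := congrArg Complex.re this
  simpa using h2.symm

lemma exists_factor {m : Type*} [Fintype m] [DecidableEq m] {A : Matrix m m ℂ}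
    (hA : A.PosSemidef) : ∃ B : EuclideanSpace ℂ m →ₗ[ℂ] EuclideanSpace ℂ m,
      ∀ u v, inner ℂ u (A.toEuclideanLin v) = inner ℂ (B u) (B v) := by
  open scoped MatrixOrder in
  obtain ⟨B, hB⟩ := CStarAlgebra.nonneg_iff_eq_star_mul_self.1 (Matrix.nonneg_iff_posSemidef.2 hA)
  refine ⟨B.toEuclideanLin, fun u v => ?_⟩
  have : A.toEuclideanLin v = B.conjTranspose.toEuclideanLin (B.toEuclideanLin v) := by
    apply (WithLp.ofLp_injective 2)
    simp [hB, Matrix.star_eq_conjTranspose]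
  rw [this, Matrix.toEuclideanLin_conjTranspose_eq_adjoint, LinearMap.adjoint_inner_right]

lemma exists_kernel {m : Type*} [Fintype m] [DecidableEq m] {A C : Matrix m m ℂ}
    (hA : A.IsHermitian) (hC : C.IsHermitian)
    (hr : ¬ LinearMap.range C.mulVecLin ≤ LinearMap.range A.mulVecLin) :
    ∃ j, hA.eigenvalues j = 0 ∧ C.toEuclideanLin (hA.eigenvectorBasis j) ≠ 0 := by
  by_contra! hcon
  apply hr
  rintro _ ⟨y, rfl⟩
  have hsymm := Matrix.isSymmetric_toEuclideanLin_iff.2 hC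
  set f := hA.eigenvectorBasis
  have h1 := f.sum_repr' (C.toEuclideanLin (WithLp.toLp 2 y))
  have h2 : C.mulVecLin y = WithLp.ofLp (C.toEuclideanLin (WithLp.toLp 2 y)) := by
    simp
  rw [h2, ← h1, WithLp.ofLp_sum]
  refine Submodule.sum_mem _ fun j _ => ?_
  rw [WithLp.ofLp_smul]
  by_cases hj : hA.eigenvalues j = 0
  · rw [← hsymm, hcon j hj]
    simp
  · refine Submodule.smul_mem _ _ ⟨((hA.eigenvalues j)⁻¹ : ℝ) • WithLp.ofLp (f j), ?_⟩
    rw [Matrix.mulVecLin_apply, Matrix.mulVec_smul, hA.mulVec_eigenvectorBasis, smul_smul,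
      inv_mul_cancel₀ hj, one_smul]

/-- If the range of `ρ₁` is not contained in the range of `ρ₀`, then
some strict convex combination `(1−x*)ρ₀ + x*ρ₁` has strictly larger von Neumann
entropy than `ρ₀`. -/
theorem exists_mixture_entropy_gt {m : Type*} [Fintype m] [DecidableEq m]
    (ρ₀ ρ₁ : Matrix m m ℂ) (h₀ : IsDensityMatrix ρ₀) (h₁ : IsDensityMatrix ρ₁)
    (hr : ¬ LinearMap.range ρ₁.mulVecLin ≤ LinearMap.range ρ₀.mulVecLin) :
    ∃ x : ℝ, x ∈ Set.Ioo (0 : ℝ) 1 ∧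
      entropy ρ₀ < entropy (((1 - x : ℝ) : ℂ) • ρ₀ + ((x : ℝ) : ℂ) • ρ₁) := by
  obtain ⟨p₀, t₀⟩ := h₀
  obtain ⟨p₁, t₁⟩ := h₁
  have H₀ := p₀.isHermitian
  obtain ⟨k, hk, hv⟩ := exists_kernel H₀ p₁.isHermitian hr
  obtain ⟨B, hB⟩ := exists_factor p₁
  set f := H₀.eigenvectorBasis with hf
  set mu := H₀.eigenvalues with hmu
  have hBv : 0 < ‖B (f k)‖ := by
    rw [norm_pos_iff]
    intro h0
    apply hv
    rw [← inner_self_eq_zero (𝕜 := ℂ), hB, h0, inner_zero_right]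
  set c : ℝ := ‖B (f k)‖ ^ 2 with hc
  have hc0 : 0 < c := by positivity
  set K : ℝ := 1 + |entropy ρ₀| with hK
  have hK1 : 1 ≤ K := by have := abs_nonneg (entropy ρ₀); linarith
  have hK0 : 0 < K := by linarith
  set N : ℝ := 2 * K / c with hN
  have hN0 : 0 < N := by positivity
  set t : ℝ := Real.exp (-N) with ht
  have ht0 : 0 < t := Real.exp_pos _
  have ht1 : t ≤ 1 := Real.exp_le_one_iff.2 (by linarith)
  set x : ℝ := t / (4 * K) with hx
  have hx0 : 0 < x := by positivity
  have hx1 : x < 1 := by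
    rw [hx, div_lt_one (by positivity)]; linarith
  refine ⟨x, ⟨hx0, hx1⟩, ?_⟩
  set ρ := ((1 - x : ℝ) : ℂ) • ρ₀ + ((x : ℝ) : ℂ) • ρ₁ with hρ
  have hps : ρ.PosSemidef := by
    refine (p₀.smul ?_).add (p₁.smul ?_)
    · rw [Complex.zero_le_real]; linarith
    · rw [Complex.zero_le_real]; linarith
  have htr : ρ.trace = 1 := by
    rw [hρ, Matrix.trace_add, Matrix.trace_smul, Matrix.trace_smul, t₀, t₁]
    simp
  have H := hps.isHermitian
  set u := H.eigenvectorBasis with hu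
  set l := H.eigenvalues with hl
  have hl0 : ∀ i, 0 ≤ l i := hps.eigenvalues_nonneg
  have hmu0 : ∀ i, 0 ≤ mu i := p₀.eigenvalues_nonneg
  have hls : ∑ i, l i = 1 := sum_eig H htr
  have hmus : ∑ i, mu i = 1 := sum_eig H₀ t₀
  have hl1 : ∀ i, l i ≤ 1 := fun i => by
    rw [← hls]
    exact Finset.single_le_sum (fun j _ => hl0 j) (Finset.mem_univ i)
  have hquad : ∀ v, (inner ℂ v (ρ.toEuclideanLin v)).re =
      (1 - x) * (inner ℂ v (ρ₀.toEuclideanLin v)).re + x * ‖B v‖ ^ 2 := by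
    intro v
    rw [hρ, map_add, map_smul, map_smul, LinearMap.add_apply, LinearMap.smul_apply,
      LinearMap.smul_apply, inner_add_right, inner_smul_right, inner_smul_right, hB,
      Complex.add_re, Complex.re_ofReal_mul, Complex.re_ofReal_mul,
      inner_self_eq_norm_sq_to_K]
    norm_cast
  set q : m → ℝ := fun i => (inner ℂ (u i) (ρ₀.toEuclideanLin (u i))).re with hq
  have hqe : ∀ i, q i = ∑ j, mu j * ‖inner ℂ (f j) (u i)‖ ^ 2 := fun i =>
    quad_eq f _ mu (eig_apply H₀) (u i)
  have hq0 : ∀ i, 0 ≤ q i := fun i => by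
    rw [hqe]
    exact Finset.sum_nonneg fun j _ => mul_nonneg (hmu0 j) (sq_nonneg _)
  have hle : ∀ i, l i = (1 - x) * q i + x * ‖B (u i)‖ ^ 2 := by
    intro i
    rw [← hquad, eig_apply H, inner_smul_right, inner_self_eq_norm_sq_to_K, u.norm_eq_one]
    simp [hl]
  have hd1 : ∀ i, ∑ j, ‖inner ℂ (f j) (u i)‖ ^ 2 = 1 := fun i => by
    rw [f.sum_sq_norm_inner_right, u.norm_eq_one, one_pow]
  have hd2 : ∀ j, ∑ i, ‖inner ℂ (f j) (u i)‖ ^ 2 = 1 := fun j => by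
    rw [u.sum_sq_norm_inner_left, f.norm_eq_one, one_pow]
  have hqs : ∑ i, q i = 1 := by
    simp_rw [hqe]
    rw [Finset.sum_comm]
    simp_rw [← Finset.mul_sum, hd2, mul_one]
    exact hmus
  have hpsum : ∑ i, ‖B (u i)‖ ^ 2 = 1 := by
    have h := hls
    simp_rw [hle, Finset.sum_add_distrib, ← Finset.mul_sum, hqs] at h
    have : x * ∑ i, ‖B (u i)‖ ^ 2 = x * 1 := by linarith
    exact mul_left_cancel₀ hx0.ne' this
  have hz : ∀ i, l i = 0 → q i = 0 ∧ ‖B (u i)‖ = 0 := by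
    intro i hi
    rw [hle] at hi
    have e1 : 0 ≤ (1 - x) * q i := mul_nonneg (by linarith) (hq0 i)
    have e2 : 0 ≤ x * ‖B (u i)‖ ^ 2 := by positivity
    have e3 : (1 - x) * q i = 0 := by linarith
    have e4 : x * ‖B (u i)‖ ^ 2 = 0 := by linarith
    constructor
    · rcases mul_eq_zero.1 e3 with h | h
      · linarith
      · exact h
    · rcases mul_eq_zero.1 e4 with h | h
      · linarith
      · exact pow_eq_zero_iff (two_ne_zero) |>.1 h
  have hS0 : entropy ρ₀ = ∑ j, Real.negMulLog (mu j) := by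
    simp [entropy, H₀, hmu]
  have hS : entropy ρ = ∑ i, Real.negMulLog (l i) := by
    simp [entropy, H, hl]
  have hkl : entropy ρ₀ ≤ ∑ i, q i * (- Real.log (l i)) := by
    rw [hS0]
    exact klein_aux (fun i j => ‖inner ℂ (f j) (u i)‖ ^ 2) q mu l (fun _ _ => sq_nonneg _)
      hd1 hd2 hmu0 hl0 hqe (fun i hi => (hz i hi).1) (hmus.trans hls.symm)
  have hSe : entropy ρ = (1 - x) * ∑ i, q i * (- Real.log (l i)) +
      x * ∑ i, ‖B (u i)‖ ^ 2 * (- Real.log (l i)) := by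
    rw [hS, Finset.mul_sum, Finset.mul_sum, ← Finset.sum_add_distrib]
    refine Finset.sum_congr rfl fun i _ => ?_
    have : Real.negMulLog (l i) = l i * (- Real.log (l i)) := by
      rw [Real.negMulLog]; ring
    rw [this]
    nth_rewrite 1 [hle i]
    ring
  have hbig := big_aux (fun i => ‖inner ℂ (u i) (f k)‖) (fun i => ‖B (u i)‖) l ‖B (f k)‖ t (x * c)
    ht0 ht1 hl0 hl1 (fun i hi => (hz i hi).2) hpsum
    (by rw [u.sum_sq_norm_inner_right, f.norm_eq_one, one_pow])
    (by
      rw [← quad_eq u _ l (eig_apply H) (f k), hquad, eig_apply H₀]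
      have : H₀.eigenvalues k = 0 := hk
      simp [this, hc])
    (norm_nonneg _)
    (by
      conv_lhs => rw [← u.sum_repr' (f k), map_sum]
      refine (norm_sum_le _ _).trans (le_of_eq ?_)
      simp [norm_smul])
  have hmain : entropy ρ₀ < ∑ i, ‖B (u i)‖ ^ 2 * (- Real.log (l i)) := by
    by_contra! hcon
    set P := ∑ i, ‖B (u i)‖ ^ 2 * (- Real.log (l i))
    have hPK : 1 + P ≤ K := by
      have := le_abs_self (entropy ρ₀); linarith
    have hlogt : Real.log t = -N := Real.log_exp _
    rw [hlogt] at hbig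
    have h3 : (1 / (1 - -N) + x * c / t) * (1 + P) ≤ (1 / (1 - -N) + x * c / t) * K := by
      refine mul_le_mul_of_nonneg_left hPK ?_
      have : 0 ≤ 1 - -N := by linarith
      positivity
    have h4 : x * c / t * K = c / 4 := by
      rw [hx]; field_simp
    have h5 : 1 / (1 - -N) * K < c / 2 := by
      have : (1 - -N) = (c + 2 * K) / c := by rw [hN]; field_simp; ring
      rw [this, one_div_div, div_mul_eq_mul_div, div_lt_div_iff₀ (by positivity) (by norm_num)]
      nlinarith
    have := hbig.trans h3
    rw [add_mul, h4, ← hc] at this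
    linarith
  rw [hSe]
  have e1 := mul_le_mul_of_nonneg_left hkl (show 0 ≤ 1 - x by linarith)
  have e2 := mul_lt_mul_of_pos_left hmain hx0
  linarith

end Paper
end

section
/- Let K be an interaction pattern on an n-partite finite-dimensional Hilbert space, let ρ be a density matrix, and let ρ̃_K be the (unique) state of maximal von Neumann entropy among all density matrices σ with γ_{K_i}(σ) = γ_{K_i}(ρ) for all K_i ∈ K. Then range(ρ) ⊆ range(ρ̃_K). -/
open scoped BigOperators ComplexOrder

namespace Paper

theorem aux_scalar {ι : Type*} [Fintype ι] (a b s : ι → ℝ) (t H : ℝ) (ht0 : 0 < t) (ht1 : t < 1)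
    (ha : ∀ i, 0 ≤ a i) (hb : ∀ i, 0 ≤ b i) (hs : ∀ i, s i = (1 - t) * a i + t * b i)
    (hasum : ∑ i, a i = 1) (hbsum : ∑ i, b i = 1)
    (h1 : ∑ i, Real.negMulLog (s i) ≤ H) (h2 : H ≤ ∑ i, Real.negMulLog (a i)) :
    ∑ i, b i * (-Real.log (s i)) ≤ H := by
  have hssum : ∑ i, s i = 1 := by
    simp only [hs, Finset.sum_add_distrib, ← Finset.mul_sum, hasum, hbsum]; ring
  have gibbs : ∀ i, Real.negMulLog (a i) + (a i - s i) ≤ a i * (-Real.log (s i)) := by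
    intro i
    have hs0 : 0 ≤ s i := by
      rw [hs]; have := ha i; have := hb i
      have : 0 ≤ 1 - t := by linarith
      positivity
    rcases (ha i).eq_or_lt with h | h
    · rw [← h]; simp [hs0]
    · have hsp : 0 < s i := by
        rw [hs]; have := hb i
        have : 0 < 1 - t := by linarith
        positivity
      have := Real.log_le_sub_one_of_pos (div_pos hsp h)
      rw [Real.log_div hsp.ne' h.ne'] at this
      have h3 := mul_le_mul_of_nonneg_left this h.le
      have : a i * (s i / a i - 1) = s i - a i := by field_simp
      rw [this] at h3
      unfold Real.negMulLog
      linarith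
  have hsum := Finset.sum_le_sum (fun i (_ : i ∈ Finset.univ) => gibbs i)
  rw [Finset.sum_add_distrib, Finset.sum_sub_distrib, hasum, hssum] at hsum
  have hS : ∑ i, Real.negMulLog (s i) =
      (1 - t) * ∑ i, a i * (-Real.log (s i)) + t * ∑ i, b i * (-Real.log (s i)) := by
    rw [Finset.mul_sum, Finset.mul_sum, ← Finset.sum_add_distrib]
    refine Finset.sum_congr rfl fun i _ => ?_
    unfold Real.negMulLog
    nth_rewrite 1 [hs i]
    ring
  have h4 : (1 - t) * H ≤ (1 - t) * ∑ i, a i * (-Real.log (s i)) :=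
    mul_le_mul_of_nonneg_left (by linarith) (by linarith)
  have h5 : t * ∑ i, b i * (-Real.log (s i)) ≤ t * H := by linarith
  exact le_of_mul_le_mul_left h5 ht0

theorem aux_row {m : Type*} [Fintype m] [DecidableEq m] (W : Matrix m m ℂ)
    (h : W * W.conjTranspose = 1) (i : m) : ∑ j, ‖W i j‖ ^ 2 = 1 := by
  have := congrFun (congrFun h i) i
  simp only [Matrix.mul_apply, Matrix.conjTranspose_apply, Matrix.one_apply_eq] at this
  have h2 : ∀ j, W i j * star (W i j) = ((‖W i j‖ ^ 2 : ℝ) : ℂ) := by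
    intro j
    have := Complex.mul_conj' (W i j)
    push_cast
    exact this
  simp only [h2] at this
  exact_mod_cast this

theorem aux_peierls {m : Type*} [Fintype m] [DecidableEq m] (A U : Matrix m m ℂ)
    (hA : A.IsHermitian) (hp : A.PosSemidef) (hU : U.conjTranspose * U = 1) :
    ∑ i, Real.negMulLog (hA.eigenvalues i) ≤
      ∑ i, Real.negMulLog ((U.conjTranspose * A * U) i i).re := by
  have hU' : U * U.conjTranspose = 1 := mul_eq_one_comm.mp hU
  obtain ⟨V, hV, hV', hspec⟩ : ∃ V : Matrix m m ℂ, V.conjTranspose * V = 1 ∧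
      V * V.conjTranspose = 1 ∧
      A = V * Matrix.diagonal (fun i => (hA.eigenvalues i : ℂ)) * V.conjTranspose := by
    refine ⟨hA.eigenvectorUnitary, ?_, ?_, ?_⟩
    · exact Unitary.coe_star_mul_self hA.eigenvectorUnitary
    · exact Unitary.coe_mul_star_self hA.eigenvectorUnitary
    · exact hA.spectral_theorem
  set α := hA.eigenvalues with hα
  have hα0 : ∀ i, 0 ≤ α i := hp.eigenvalues_nonneg
  set W := U.conjTranspose * V with hW
  have hW1 : W * W.conjTranspose = 1 := by
    rw [hW, Matrix.conjTranspose_mul, Matrix.conjTranspose_conjTranspose]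
    calc _ = U.conjTranspose * (V * V.conjTranspose) * U := by simp only [Matrix.mul_assoc]
      _ = 1 := by rw [hV', Matrix.mul_one, hU]
  have hW2 : W.conjTranspose * W = 1 := mul_eq_one_comm.mp hW1
  have hdiag : ∀ i, ((U.conjTranspose * A * U) i i).re = ∑ j, ‖W i j‖ ^ 2 * α j := by
    intro i
    have : U.conjTranspose * A * U =
        W * Matrix.diagonal (fun i => (α i : ℂ)) * W.conjTranspose := by
      rw [hW, Matrix.conjTranspose_mul, Matrix.conjTranspose_conjTranspose]
      conv_lhs => rw [hspec]
      simp only [Matrix.mul_assoc]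
    rw [this, Matrix.mul_apply, Complex.re_sum]
    refine Finset.sum_congr rfl fun j _ => ?_
    rw [Matrix.mul_diagonal, Matrix.conjTranspose_apply]
    have h2 : W i j * (α j : ℂ) * star (W i j) = ((‖W i j‖ ^ 2 * α j : ℝ) : ℂ) := by
      have := Complex.mul_conj' (W i j)
      push_cast
      rw [← this, starRingEnd_apply]; ring
    rw [h2, Complex.ofReal_re]
  have hcol : ∀ j, ∑ i, ‖W i j‖ ^ 2 = 1 := by
    intro j
    have := aux_row W.conjTranspose (by rw [Matrix.conjTranspose_conjTranspose, hW2]) j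
    simpa using this
  calc ∑ j, Real.negMulLog (α j) = ∑ j, (∑ i, ‖W i j‖ ^ 2) * Real.negMulLog (α j) := by
        simp [hcol]
    _ = ∑ i, ∑ j, ‖W i j‖ ^ 2 * Real.negMulLog (α j) := by
        simp only [Finset.sum_mul]; exact Finset.sum_comm
    _ ≤ _ := by
        refine Finset.sum_le_sum fun i _ => ?_
        rw [hdiag]
        have := Real.concaveOn_negMulLog.le_map_sum (t := Finset.univ)
          (w := fun j => ‖W i j‖ ^ 2) (p := α) (fun _ _ => by positivity) (aux_row W hW1 i)
          (fun j _ => hα0 j)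
        simpa only [smul_eq_mul] using this

theorem aux_cs {m : Type*} [Fintype m] [DecidableEq m] (B : Matrix m m ℂ) (hB : B.PosSemidef)
    (v : m → ℂ) (i : m) :
    ‖(B.mulVec v) i‖ ^ 2 ≤ (B i i).re * (star v ⬝ᵥ B.mulVec v).re := by
  obtain ⟨C, rfl⟩ : ∃ C : Matrix m m ℂ, B = C.conjTranspose * C := by
    open scoped MatrixOrder in
    exact CStarAlgebra.nonneg_iff_eq_star_mul_self.mp hB.nonneg
  have e1 : ((C.conjTranspose * C) i i).re = ∑ k, ‖C k i‖ ^ 2 := by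
    rw [Matrix.mul_apply, Complex.re_sum]
    refine Finset.sum_congr rfl fun k _ => ?_
    rw [Matrix.conjTranspose_apply]
    have := Complex.conj_mul' (C k i)
    rw [← starRingEnd_apply, this]
    exact_mod_cast Complex.ofReal_re _
  have e2 : (star v ⬝ᵥ (C.conjTranspose * C).mulVec v).re = ∑ k, ‖C.mulVec v k‖ ^ 2 := by
    rw [← Matrix.mulVec_mulVec, Matrix.dotProduct_mulVec, ← Matrix.star_mulVec, dotProduct,
      Complex.re_sum]
    refine Finset.sum_congr rfl fun k _ => ?_
    have := Complex.conj_mul' (C.mulVec v k)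
    rw [Pi.star_apply, ← starRingEnd_apply, this]
    exact_mod_cast Complex.ofReal_re _
  rw [e1, e2, ← Matrix.mulVec_mulVec]
  refine le_trans ?_ (Finset.sum_mul_sq_le_sq_mul_sq Finset.univ _ _)
  refine pow_le_pow_left₀ (norm_nonneg _) ?_ 2
  refine (norm_sum_le _ _).trans (le_of_eq ?_)
  refine Finset.sum_congr rfl fun k _ => ?_
  rw [norm_mul]
  congr 1
  exact norm_star (C k i)

/-- Choice of a small parameter for which the entropy estimate fails. -/
theorem aux_main {m : Type*} [Fintype m] [DecidableEq m] (A B : Matrix m m ℂ)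
    (hA : IsDensityMatrix A) (hB : IsDensityMatrix B)
    (hmax : ∀ t : ℝ, 0 < t → t < 1 →
      entropy (((1 - t : ℝ) : ℂ) • A + (t : ℂ) • B) ≤ entropy A)
    (v : m → ℂ) (hv : A.mulVec v = 0) : B.mulVec v = 0 := by
  rw [← hB.1.dotProduct_mulVec_zero_iff]
  by_contra hne
  have hnn := hB.1.dotProduct_mulVec_nonneg v
  set b : ℝ := (star v ⬝ᵥ B.mulVec v).re with hbdef
  have hbC : star v ⬝ᵥ B.mulVec v = (b : ℂ) := by
    rw [Complex.nonneg_iff] at hnn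
    exact Complex.ext (by simp [hbdef]) (by simp [← hnn.2])
  have hb : 0 < b := by
    rcases (Complex.nonneg_iff.mp hnn).1.eq_or_lt with h | h
    · exact absurd (by rw [hbC, hbdef, ← h]; simp) hne
    · exact h
  set N : ℝ := (Fintype.card m : ℝ) with hN
  have hm : Nonempty m := by
    by_contra h
    rw [not_nonempty_iff] at h
    exact hne (by simp [dotProduct])
  have hN1 : 1 ≤ N := by
    rw [hN]; exact_mod_cast Fintype.card_pos (α := m)
  set R : ℝ := ∑ i, ‖v i‖ ^ 2 with hR
  have hR0 : 0 ≤ R := Finset.sum_nonneg fun _ _ => by positivity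
  set β : ℝ := b / (N ^ 2 * (R + 1)) with hβ
  have hβ0 : 0 < β := by positivity
  set L : ℝ := |entropy A| / β + 1 with hL
  have hL0 : 0 < L := by positivity
  set t : ℝ := Real.exp (-L) / N with ht
  have ht0 : 0 < t := by positivity
  have ht1 : t < 1 := by
    rw [ht, div_lt_one (by linarith)]
    exact lt_of_lt_of_le (by rw [← Real.exp_zero]; exact Real.exp_lt_exp.mpr (by linarith)) hN1
  set σ : Matrix m m ℂ := ((1 - t : ℝ) : ℂ) • A + (t : ℂ) • B with hσdef
  have hσ : σ.PosSemidef := (hA.1.smul (by exact_mod_cast (by linarith : (0:ℝ) ≤ 1 - t))).add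
    (hB.1.smul (by exact_mod_cast ht0.le))
  have hm := hmax t ht0 ht1
  obtain ⟨U, hU, hU', hspec⟩ : ∃ U : Matrix m m ℂ, U.conjTranspose * U = 1 ∧
      U * U.conjTranspose = 1 ∧
      σ = U * Matrix.diagonal (fun i => (hσ.1.eigenvalues i : ℂ)) * U.conjTranspose := by
    refine ⟨hσ.1.eigenvectorUnitary, ?_, ?_, ?_⟩
    · exact Unitary.coe_star_mul_self hσ.1.eigenvectorUnitary
    · exact Unitary.coe_mul_star_self hσ.1.eigenvectorUnitary
    · exact hσ.1.spectral_theorem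
  have hent : entropy A = ∑ i, Real.negMulLog (hA.1.1.eigenvalues i) := by
    rw [entropy, dif_pos hA.1.1]
  have hentσ : entropy σ = ∑ i, Real.negMulLog (hσ.1.eigenvalues i) := by
    rw [entropy, dif_pos hσ.1]
  set s := hσ.1.eigenvalues with hs
  have hs0 : ∀ i, 0 ≤ s i := hσ.eigenvalues_nonneg
  set A' := U.conjTranspose * A * U with hA'
  set B' := U.conjTranspose * B * U with hB'
  have hA'p : A'.PosSemidef := hA.1.conjTranspose_mul_mul_same U
  have hB'p : B'.PosSemidef := hB.1.conjTranspose_mul_mul_same U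
  have hdec : Matrix.diagonal (fun i => (s i : ℂ)) = ((1 - t : ℝ) : ℂ) • A' + (t : ℂ) • B' := by
    calc Matrix.diagonal (fun i => (s i : ℂ))
        = (U.conjTranspose * U) * Matrix.diagonal (fun i => (s i : ℂ)) *
            (U.conjTranspose * U) := by rw [hU]; simp
      _ = U.conjTranspose * σ * U := by rw [hspec]; simp only [Matrix.mul_assoc]
      _ = _ := by
        rw [hσdef, hA', hB']
        simp only [Matrix.mul_add, Matrix.add_mul, Matrix.mul_smul, Matrix.smul_mul]
  have tr : ∀ M : Matrix m m ℂ, M.trace = 1 → ∑ i, ((U.conjTranspose * M * U) i i).re = 1 := by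
    intro M hM
    rw [← Complex.re_sum]
    have : (U.conjTranspose * M * U).trace = 1 := by
      rw [Matrix.trace_mul_comm, ← Matrix.mul_assoc, hU', Matrix.one_mul, hM]
    rw [Matrix.trace] at this
    simp only [Matrix.diag_apply] at this
    rw [this]; simp
  have ha0 : ∀ i, 0 ≤ (A' i i).re := fun i => (Complex.nonneg_iff.mp hA'p.diag_nonneg).1
  have hb0 : ∀ i, 0 ≤ (B' i i).re := fun i => (Complex.nonneg_iff.mp hB'p.diag_nonneg).1
  have hsi : ∀ i, s i = (1 - t) * (A' i i).re + t * (B' i i).re := by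
    intro i
    have := congrArg Complex.re (congrFun (congrFun hdec i) i)
    simpa using this
  have hasum := tr A hA.2
  have hbsum := tr B hB.2
  have hsc := aux_scalar (fun i => (A' i i).re) (fun i => (B' i i).re) s t (entropy A) ht0 ht1
    ha0 hb0 hsi hasum hbsum (by rw [← hentσ]; exact hm)
    (by rw [hent]; exact aux_peierls A U hA.1.1 hA.1 hU)
  have ha1 : ∀ i, (A' i i).re ≤ 1 := fun i => by
    rw [← hasum]; exact Finset.single_le_sum (fun j _ => ha0 j) (Finset.mem_univ i)
  have hb1 : ∀ i, (B' i i).re ≤ 1 := fun i => by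
    rw [← hbsum]; exact Finset.single_le_sum (fun j _ => hb0 j) (Finset.mem_univ i)
  have hs1 : ∀ i, s i ≤ 1 := fun i => by
    rw [hsi]; nlinarith [ha1 i, hb1 i]
  have hterm : ∀ i, (B' i i).re * (-Real.log (s i)) ≤ entropy A := fun i =>
    (Finset.single_le_sum (f := fun i => (B' i i).re * (-Real.log (s i)))
      (fun j _ => mul_nonneg (hb0 j) (by linarith [Real.log_nonpos (hs0 j) (hs1 j)]))
      (Finset.mem_univ i)).trans hsc
  -- transform the vector
  set v' := U.conjTranspose.mulVec v with hv'
  have hUv : U.mulVec v' = v := by rw [hv', Matrix.mulVec_mulVec, hU', Matrix.one_mulVec]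
  have hAv' : A'.mulVec v' = 0 := by
    rw [hA', ← Matrix.mulVec_mulVec, hUv, ← Matrix.mulVec_mulVec, hv, Matrix.mulVec_zero]
  have hBv' : B'.mulVec v' = U.conjTranspose.mulVec (B.mulVec v) := by
    rw [hB', ← Matrix.mulVec_mulVec, hUv, ← Matrix.mulVec_mulVec]
  have hq : star v' ⬝ᵥ B'.mulVec v' = (b : ℂ) := by
    rw [hBv', Matrix.dotProduct_mulVec, ← Matrix.star_mulVec, hUv, hbC]
  have hnorm : ∑ i, ‖v' i‖ ^ 2 = R := by
    have key : ∀ w : m → ℂ, star w ⬝ᵥ w = ((∑ i, ‖w i‖ ^ 2 : ℝ) : ℂ) := by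
      intro w
      rw [dotProduct]
      push_cast
      refine Finset.sum_congr rfl fun k _ => ?_
      exact Complex.conj_mul' (w k)
    have h1 : star v' ⬝ᵥ v' = star v ⬝ᵥ v := by
      conv_lhs => rw [hv', Matrix.dotProduct_mulVec, ← hv', ← Matrix.star_mulVec, hUv]
    rw [key, key] at h1
    exact_mod_cast h1
  set w := B'.mulVec v' with hw
  have hrel : ∀ i, s i * ‖v' i‖ = t * ‖w i‖ := by
    intro i
    have h1 : (Matrix.diagonal (fun i => (s i : ℂ))).mulVec v' = (t : ℂ) • w := by
      rw [hdec, Matrix.add_mulVec, Matrix.smul_mulVec, Matrix.smul_mulVec, hAv', smul_zero,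
        zero_add]
    have h2 := congrArg norm (congrFun h1 i)
    rw [Matrix.mulVec_diagonal, norm_mul, Pi.smul_apply, smul_eq_mul, norm_mul,
      Complex.norm_real, Complex.norm_real, Real.norm_of_nonneg (hs0 i),
      Real.norm_of_nonneg ht0.le] at h2
    exact h2
  have hcs : ∀ i, ‖w i‖ ^ 2 ≤ (B' i i).re * b := by
    intro i
    have := aux_cs B' hB'p v' i
    rwa [← hw, hq, Complex.ofReal_re] at this
  have hbsumle : b ≤ ∑ i, ‖v' i‖ * ‖w i‖ := by
    calc b = ‖(b : ℂ)‖ := by rw [Complex.norm_real, Real.norm_of_nonneg hb.le]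
      _ = ‖star v' ⬝ᵥ w‖ := by rw [hq]
      _ ≤ _ := by
        refine (norm_sum_le _ _).trans (le_of_eq ?_)
        refine Finset.sum_congr rfl fun k _ => ?_
        rw [norm_mul, Pi.star_apply, norm_star]
  obtain ⟨i, -, hi⟩ : ∃ i ∈ Finset.univ, b / N ≤ ‖v' i‖ * ‖w i‖ := by
    apply Finset.exists_le_of_sum_le Finset.univ_nonempty
    rw [Finset.sum_const, Finset.card_univ, nsmul_eq_mul, ← hN, mul_div_cancel₀ _ (by positivity)]
    exact hbsumle
  have hx0 : 0 < b / N := by positivity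
  have hvi : ‖v' i‖ ^ 2 ≤ R := by
    rw [← hnorm]
    exact Finset.single_le_sum (f := fun i => ‖v' i‖ ^ 2) (fun _ _ => by positivity)
      (Finset.mem_univ i)
  -- lower bound on `b_i`
  have hβi : β ≤ (B' i i).re := by
    have h1 : (b / N) ^ 2 ≤ (R + 1) * ((B' i i).re * b) := by
      calc (b / N) ^ 2 ≤ (‖v' i‖ * ‖w i‖) ^ 2 := pow_le_pow_left₀ hx0.le hi 2
        _ = ‖v' i‖ ^ 2 * ‖w i‖ ^ 2 := by ring
        _ ≤ (R + 1) * ((B' i i).re * b) :=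
          mul_le_mul (by linarith) (hcs i) (by positivity) (by positivity)
    rw [hβ, div_le_iff₀ (by positivity)]
    have h2 : (b / N) ^ 2 * N ^ 2 = b ^ 2 := by field_simp
    have h3 := mul_le_mul_of_nonneg_right h1 (sq_nonneg N)
    rw [h2] at h3
    have h4 : b * b ≤ b * ((B' i i).re * (N ^ 2 * (R + 1))) := by linarith
    exact le_of_mul_le_mul_left h4 hb
  -- upper bound on `s_i`
  have hsile : s i ≤ t * N := by
    have h1 : s i * (b / N) ≤ t * b := by
      calc s i * (b / N) ≤ s i * (‖v' i‖ * ‖w i‖) := mul_le_mul_of_nonneg_left hi (hs0 i)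
        _ = t * ‖w i‖ ^ 2 := by rw [← mul_assoc, hrel]; ring
        _ ≤ t * b := by
          refine mul_le_mul_of_nonneg_left ((hcs i).trans ?_) ht0.le
          nlinarith [hb1 i]
    have h2 : s i * (b / N) * N = s i * b := by field_simp
    have h3 := mul_le_mul_of_nonneg_right h1 (by positivity : 0 ≤ N)
    rw [h2] at h3
    have h4 : b * s i ≤ b * (t * N) := by linarith
    exact le_of_mul_le_mul_left h4 hb
  have hsipos : 0 < s i := by
    rw [hsi]
    have := ha0 i
    have h1 : 0 < t * (B' i i).re := mul_pos ht0 (lt_of_lt_of_le hβ0 hβi)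
    have h2 : 0 ≤ (1 - t) * (A' i i).re := mul_nonneg (by linarith) this
    linarith
  have htN : t * N = Real.exp (-L) := by rw [ht]; field_simp
  have hlog : L ≤ -Real.log (s i) := by
    have := Real.log_le_log hsipos hsile
    rw [htN, Real.log_exp] at this
    linarith
  have h5 : β * L ≤ entropy A :=
    (mul_le_mul hβi hlog hL0.le (hb0 i)).trans (hterm i)
  have h6 : β * L = |entropy A| + β := by rw [hL]; field_simp
  have := le_abs_self (entropy A)
  linarith

theorem aux_rdm {n : ℕ} {d : Fin n → ℕ} (K : Finset (Fin n)) (x y : ℂ)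
    (A B : Matrix (Idx d) (Idx d) ℂ) :
    rdm K (x • A + y • B) = x • rdm K A + y • rdm K B := by
  ext a b
  simp [rdm, Finset.sum_add_distrib, Finset.mul_sum]

theorem aux_range {m : Type*} [Fintype m] [DecidableEq m] (A B : Matrix m m ℂ)
    (hA : A.IsHermitian) (hB : B.IsHermitian)
    (h : ∀ v, A.mulVec v = 0 → B.mulVec v = 0) :
    LinearMap.range B.mulVecLin ≤ LinearMap.range A.mulVecLin := by
  rintro _ ⟨x, rfl⟩
  by_contra hy
  obtain ⟨f, hf, hle⟩ := Submodule.exists_le_ker_of_notMem hy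
  obtain ⟨w, hw⟩ : ∃ w : m → ℂ, ∀ z, f z = w ⬝ᵥ z := by
    refine ⟨fun i => f (Pi.single i 1), fun z => ?_⟩
    rw [LinearMap.pi_apply_eq_sum_univ f z, dotProduct]
    refine Finset.sum_congr rfl fun i _ => ?_
    rw [smul_eq_mul, mul_comm]
    congr 2
    ext j
    simp [Pi.single_apply, eq_comm]
  have h1 : Matrix.vecMul w A = 0 := by
    refine dotProduct_eq_zero _ fun z => ?_
    rw [← Matrix.dotProduct_mulVec, ← hw]
    exact hle ⟨z, rfl⟩
  have h2 : A.mulVec (star w) = 0 := by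
    have := congrArg star h1
    rwa [Matrix.star_vecMul, hA.eq, star_zero] at this
  have h3 := congrArg star (h _ h2)
  rw [Matrix.star_mulVec, hB.eq, star_star, star_zero] at h3
  apply hf
  rw [hw, Matrix.mulVecLin_apply, Matrix.dotProduct_mulVec, h3, zero_dotProduct]

/-- The range of `ρ` is contained in the range of the maximal-entropy
state `ρ̃_𝒦` among all states with the same reduced density matrices as `ρ`. -/
theorem range_le_range_entropy_maximizer {n : ℕ} {d : Fin n → ℕ}
    (𝒦 : Finset (Finset (Fin n))) (ρ ρt : Matrix (Idx d) (Idx d) ℂ)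
    (hρ : IsDensityMatrix ρ) (hρt : IsDensityMatrix ρt)
    (hrdm : ∀ K ∈ 𝒦, rdm K ρt = rdm K ρ)
    (hmax : ∀ σ : Matrix (Idx d) (Idx d) ℂ, IsDensityMatrix σ →
      (∀ K ∈ 𝒦, rdm K σ = rdm K ρ) → entropy σ ≤ entropy ρt) :
    LinearMap.range ρ.mulVecLin ≤ LinearMap.range ρt.mulVecLin := by
  refine aux_range ρt ρ hρt.1.1 hρ.1.1 fun v hv => aux_main ρt ρ hρt hρ (fun t ht0 ht1 => ?_) v hv
  refine hmax _ ⟨(hρt.1.smul (by exact_mod_cast (by linarith : (0:ℝ) ≤ 1 - t))).add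
    (hρ.1.smul (by exact_mod_cast ht0.le)), ?_⟩ fun K hK => ?_
  · rw [Matrix.trace_add, Matrix.trace_smul, Matrix.trace_smul, hρt.2, hρ.2]
    simp
  · rw [aux_rdm, hrdm K hK, ← add_smul]
    simp

end Paper
end
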